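/- Let n ≥ 3, let k be a field, let S = k[X_0, X_1, …, X_n], let 𝔞 ⊆ S be the ideal generated by the 2×2 minors of the matrix with rows (X_0, …, X_{n−1}) and (X_1, …, X_n), and let A = S/𝔞 with x_i the image of X_i. Let I = (x_0, x_1, x_n) and Q = (x_0, x_n). Then I^n = Q·I^{n−1} and x_1^{n−1} ∉ Q·I^{n−2}; that is, r_Q(I) = n − 1. -/

import Mathlib

set_option synthInstance.maxHeartbeats 1000000

open MvPolynomial

/-- The reduction number `r_Q(I) = inf { m ≥ 0 | I^(m+1) = Q·I^m }`. -/
noncomputable def redNum {A : Type*} [CommRing A] (Q I : Ideal A) : ℕ∞ :=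
  sInf {l : ℕ∞ | ∃ m : ℕ, l = (m : ℕ∞) ∧ I ^ (m + 1) = Q * I ^ m}

/-- If `I = Q + (b)`, then `I^(m+1) = Q·I^m + (b^(m+1))`; this is the inclusion needed to bound
reduction numbers from above. -/
theorem sup_span_singleton_pow_succ_le {A : Type*} [CommRing A] (Q : Ideal A) (b : A) (m : ℕ) :
    (Q ⊔ Ideal.span {b}) ^ (m + 1) ≤
      Q * (Q ⊔ Ideal.span {b}) ^ m ⊔ Ideal.span {b ^ (m + 1)} := by
  induction m with
  | zero => simp
  | succ m ih =>
    set I := Q ⊔ Ideal.span {b} with hI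
    have hb : Ideal.span {b} ≤ I := le_sup_right
    calc I ^ (m + 1 + 1) = Q * I ^ (m + 1) ⊔ Ideal.span {b} * I ^ (m + 1) := by
          rw [pow_succ' I (m + 1), ← Ideal.sup_mul]
      _ ≤ Q * I ^ (m + 1) ⊔ Ideal.span {b} * (Q * I ^ m ⊔ Ideal.span {b ^ (m + 1)}) :=
          sup_le_sup le_rfl (Ideal.mul_mono le_rfl ih)
      _ ≤ Q * I ^ (m + 1) ⊔ Ideal.span {b ^ (m + 1 + 1)} := by
          rw [Ideal.mul_sup, Ideal.span_singleton_mul_span_singleton, ← pow_succ']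
          refine sup_le le_sup_left (sup_le ?_ le_sup_right)
          refine le_sup_of_le_left ?_
          rw [mul_left_comm, pow_succ']
          exact Ideal.mul_mono le_rfl (Ideal.mul_mono hb le_rfl)

theorem span_triple_eq_sup {A : Type*} [CommRing A] (a b c : A) :
    (Ideal.span {a, b, c} : Ideal A) = Ideal.span {a, c} ⊔ Ideal.span {b} := by
  rw [← Ideal.span_union]
  congr 1
  ext y
  simp
  tauto

theorem span_triple_pow_succ_eq {A : Type*} [CommRing A] (a b c : A) (m : ℕ)
    (h : b ^ (m + 1) = a ^ m * c) :
    (Ideal.span {a, b, c} : Ideal A) ^ (m + 1) =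
      Ideal.span {a, c} * Ideal.span {a, b, c} ^ m := by
  have ha : a ∈ (Ideal.span {a, b, c} : Ideal A) := Ideal.subset_span (by simp)
  have hc : c ∈ (Ideal.span {a, c} : Ideal A) := Ideal.subset_span (by simp)
  apply le_antisymm
  · have hmem : b ^ (m + 1) ∈ (Ideal.span {a, c} : Ideal A) * Ideal.span {a, b, c} ^ m := by
      rw [h, mul_comm (a ^ m)]
      exact Ideal.mul_mem_mul hc (Ideal.pow_mem_pow ha m)
    have key := sup_span_singleton_pow_succ_le (Ideal.span {a, c}) b m
    rw [← span_triple_eq_sup] at key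
    exact key.trans (sup_le le_rfl ((Ideal.span_singleton_le_iff_mem _).2 hmem))
  · rw [pow_succ']
    refine Ideal.mul_mono (Ideal.span_mono ?_) le_rfl
    intro y
    simp
    tauto

theorem redNum_eq_of_pow_notMem {A : Type*} [CommRing A] {Q I : Ideal A} {b : A} (m : ℕ)
    (hb : b ∈ I) (h : I ^ (m + 2) = Q * I ^ (m + 1)) (hnot : b ^ (m + 1) ∉ Q * I ^ m) :
    redNum Q I = ((m + 1 : ℕ) : ℕ∞) := by
  apply le_antisymm
  · exact sInf_le ⟨m + 1, rfl, h⟩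
  · refine le_sInf ?_
    rintro _ ⟨l, rfl, hl⟩
    by_contra! hlt
    obtain ⟨d, rfl⟩ : ∃ d, m = l + d := ⟨m - l, by have := Nat.cast_lt.1 hlt; omega⟩
    apply hnot
    have heq : I ^ (l + d + 1) = Q * I ^ (l + d) := by
      rw [add_right_comm, pow_add, hl, mul_assoc, ← pow_add]
    exact heq ▸ Ideal.pow_mem_pow hb _

/-- If `b * x j = x 0 * x (j+1)` along the sequence `b = x 1, x 2, …, x n`, then
`b ^ (j+1) = x 0 ^ j * x (j+1)`. -/
theorem pow_succ_eq_of_mul_eq {A : Type*} [CommRing A] (x : ℕ → A) (n : ℕ)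
    (h : ∀ j, 0 < j → j + 1 ≤ n → x 1 * x j = x 0 * x (j + 1)) (j : ℕ) (hj : j + 1 ≤ n) :
    x 1 ^ (j + 1) = x 0 ^ j * x (j + 1) := by
  induction j with
  | zero => simp
  | succ j ih =>
    rw [pow_succ', ih (by omega), mul_left_comm, h (j + 1) (by omega) hj]
    ring

theorem Polynomial.X_pow_mul_C_X_pow_notMem_span (k : Type*) [Field k] (N m : ℕ) :
    (Polynomial.X ^ N * Polynomial.C (Polynomial.X ^ m) : Polynomial (Polynomial k)) ∉
      Ideal.span {Polynomial.X ^ (N + 1), Polynomial.C (Polynomial.X ^ (m + 1))} := by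
  intro h
  obtain ⟨f, g, hfg⟩ := Ideal.mem_span_pair.1 h
  have hN := congrArg (fun p => Polynomial.coeff p N) hfg
  simp only [Polynomial.coeff_add, Polynomial.coeff_mul_C, Polynomial.coeff_X_pow_self, one_mul,
    Polynomial.coeff_mul_X_pow', Nat.not_succ_le_self, if_false, zero_add] at hN
  have hdvd : (Polynomial.X : Polynomial k) ^ (m + 1) ∣ Polynomial.X ^ m :=
    ⟨_, (hN.symm.trans (mul_comm _ _))⟩
  have := (pow_dvd_pow_iff Polynomial.X_ne_zero Polynomial.not_isUnit_X).1 hdvd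
  omega

theorem pow_notMem_of_ringHom {A B : Type*} [CommRing A] [CommRing B] (φ : A →+* B)
    {a b c : A} {s t : B} (m : ℕ) (ha : φ a = s ^ (m + 2)) (hb : φ b = s ^ (m + 1) * t)
    (hc : φ c = 0) (hs : s ^ ((m + 1) ^ 2 + 1) = 0) (hst : s ^ ((m + 1) ^ 2) * t ^ (m + 1) ≠ 0) :
    b ^ (m + 1) ∉ (Ideal.span {a, c} : Ideal A) * Ideal.span {a, b, c} ^ m := by
  intro h
  have hQ : Ideal.map φ (Ideal.span {a, c}) ≤ Ideal.span {s ^ (m + 2)} := by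
    rw [Ideal.map_span, Ideal.span_le]
    rintro _ ⟨y, rfl | rfl, rfl⟩
    · rw [ha]
      exact Ideal.mem_span_singleton_self _
    · rw [hc]
      exact zero_mem _
  have hI : Ideal.map φ (Ideal.span {a, b, c}) ≤ Ideal.span {s ^ (m + 1)} := by
    rw [Ideal.map_span, Ideal.span_le]
    rintro _ ⟨y, rfl | rfl | rfl, rfl⟩
    · rw [ha]
      exact Ideal.mem_span_singleton.2 (pow_dvd_pow s (by omega))
    · rw [hb]
      exact Ideal.mem_span_singleton.2 (dvd_mul_right _ _)
    · rw [hc]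
      exact zero_mem _
  have hmem := Ideal.mem_map_of_mem φ h
  rw [Ideal.map_mul, Ideal.map_pow] at hmem
  have hle := Ideal.mul_mono hQ (Ideal.pow_right_mono hI m) hmem
  rw [Ideal.span_singleton_pow, Ideal.span_singleton_mul_span_singleton, ← pow_mul, ← pow_add,
    show m + 2 + (m + 1) * m = (m + 1) ^ 2 + 1 by ring, hs, Ideal.mem_span_singleton,
    zero_dvd_iff, map_pow, hb, mul_pow, ← pow_mul, ← sq] at hle
  exact hst hle

/-- **Example 4.1 (1).**  Let `n ≥ 3`, `S = k[X 0, …, X n]`, `𝔞` the ideal of 2×2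
minors of the matrix with rows `(X 0, …, X (n-1))` and `(X 1, …, X n)`, and
`A = S/𝔞` with `x i` the image of `X i`.  For `I = (x 0, x 1, x n)` and
`Q = (x 0, x n)` one has `I^n = Q·I^(n-1)` and `x 1 ^ (n-1) ∉ Q·I^(n-2)`; that is,
`r_Q(I) = n − 1`. -/
theorem reduction_number_example_one (n : ℕ) (hn : 3 ≤ n) (k : Type*) [Field k]
    (𝔞 : Ideal (MvPolynomial (Fin (n + 1)) k))
    (h𝔞 : 𝔞 = Ideal.span {f | ∃ (i j : ℕ) (hij : i < j) (hj : j + 1 ≤ n),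
      f = X (⟨i, by omega⟩ : Fin (n + 1)) * X (⟨j + 1, by omega⟩ : Fin (n + 1))
        - X (⟨i + 1, by omega⟩ : Fin (n + 1)) * X (⟨j, by omega⟩ : Fin (n + 1))})
    (x : Fin (n + 1) → MvPolynomial (Fin (n + 1)) k ⧸ 𝔞)
    (hx : ∀ i, x i = Ideal.Quotient.mk 𝔞 (X i))
    (I Q : Ideal (MvPolynomial (Fin (n + 1)) k ⧸ 𝔞))
    (hI : I = Ideal.span {x ⟨0, by omega⟩, x ⟨1, by omega⟩, x ⟨n, by omega⟩})
    (hQ : Q = Ideal.span {x ⟨0, by omega⟩, x ⟨n, by omega⟩}) :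
    I ^ n = Q * I ^ (n - 1) ∧ x ⟨1, by omega⟩ ^ (n - 1) ∉ Q * I ^ (n - 2) ∧
      redNum Q I = ((n - 1 : ℕ) : ℕ∞) := by
  obtain ⟨m, rfl⟩ : ∃ m, n = m + 2 := ⟨n - 2, by omega⟩
  let y : ℕ → MvPolynomial (Fin (m + 2 + 1)) k ⧸ 𝔞 :=
    fun j => if hj : j < m + 2 + 1 then x ⟨j, hj⟩ else 0
  have hy : ∀ (j : ℕ) (hj : j < m + 2 + 1), y j = x ⟨j, hj⟩ := fun j hj => dif_pos hj
  have hrel : ∀ j, 0 < j → j + 1 ≤ m + 2 → y 1 * y j = y 0 * y (j + 1) := by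
    intro j hj0 hj
    rw [hy 1 (by omega), hy j (by omega), hy 0 (by omega), hy (j + 1) (by omega), hx, hx, hx, hx,
      ← map_mul, ← map_mul, eq_comm, Ideal.Quotient.eq]
    rw [h𝔞]
    exact Ideal.subset_span ⟨0, j, hj0, hj, rfl⟩
  have hpow : x ⟨1, by omega⟩ ^ (m + 1 + 1) =
      x ⟨0, by omega⟩ ^ (m + 1) * x ⟨m + 2, by omega⟩ := by
    have := pow_succ_eq_of_mul_eq y (m + 2) hrel (m + 1) le_rfl
    rwa [hy 1 (by omega), hy 0 (by omega), hy (m + 1 + 1) (by omega)] at this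
  have hred : I ^ (m + 2) = Q * I ^ (m + 1) := by
    rw [hI, hQ]
    exact span_triple_pow_succ_eq _ _ _ (m + 1) hpow
  let K : Ideal (Polynomial (Polynomial k)) :=
    Ideal.span {Polynomial.X ^ ((m + 1) ^ 2 + 1), Polynomial.C (Polynomial.X ^ (m + 1 + 1))}
  let s : Polynomial (Polynomial k) ⧸ K := Ideal.Quotient.mk K Polynomial.X
  let t : Polynomial (Polynomial k) ⧸ K := Ideal.Quotient.mk K (Polynomial.C Polynomial.X)
  have hs : s ^ ((m + 1) ^ 2 + 1) = 0 := by
    rw [← map_pow, Ideal.Quotient.eq_zero_iff_mem]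
    exact Ideal.subset_span (Set.mem_insert _ _)
  have ht : t ^ (m + 2) = 0 := by
    rw [← map_pow, ← Polynomial.C_pow, Ideal.Quotient.eq_zero_iff_mem]
    exact Ideal.subset_span (Set.mem_insert_of_mem _ rfl)
  have hst : s ^ ((m + 1) ^ 2) * t ^ (m + 1) ≠ 0 := by
    rw [← map_pow, ← map_pow, ← map_mul, ← Polynomial.C_pow, Ne, Ideal.Quotient.eq_zero_iff_mem]
    exact Polynomial.X_pow_mul_C_X_pow_notMem_span k _ _
  let c : k →+* Polynomial (Polynomial k) ⧸ K :=
    (Ideal.Quotient.mk K).comp (Polynomial.C.comp Polynomial.C)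
  let ψ : MvPolynomial (Fin (m + 2 + 1)) k →+* Polynomial (Polynomial k) ⧸ K :=
    eval₂Hom c fun i : Fin (m + 2 + 1) => s ^ (m + 2 - (i : ℕ)) * t ^ (i : ℕ)
  have hψX : ∀ i, ψ (X i) = s ^ (m + 2 - (i : ℕ)) * t ^ (i : ℕ) := fun i => eval₂Hom_X' _ _ _
  have hker : ∀ f ∈ 𝔞, ψ f = 0 := by
    intro f hf
    suffices hle : 𝔞 ≤ RingHom.ker ψ from hle hf
    rw [h𝔞, Ideal.span_le]
    rintro _ ⟨i, j, hij, hj, rfl⟩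
    rw [SetLike.mem_coe, RingHom.mem_ker, map_sub, map_mul, map_mul, hψX, hψX, hψX, hψX]
    obtain ⟨d, hd⟩ : ∃ d, m + 2 = j + 1 + d := ⟨m + 2 - (j + 1), by omega⟩
    obtain ⟨e, rfl⟩ : ∃ e, j = i + e := ⟨j - i, by omega⟩
    simp only [show m + 2 - i = e + 1 + d by omega, show m + 2 - (i + e + 1) = d by omega,
      show m + 2 - (i + 1) = e + d by omega, show m + 2 - (i + e) = d + 1 by omega]
    ring
  let φ := Ideal.Quotient.lift 𝔞 ψ hker
  have hφ : ∀ i, φ (x i) = s ^ (m + 2 - (i : ℕ)) * t ^ (i : ℕ) := by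
    intro i
    rw [hx, Ideal.Quotient.lift_mk, hψX]
  have hnot : x ⟨1, by omega⟩ ^ (m + 1) ∉ Q * I ^ m := by
    rw [hI, hQ]
    refine pow_notMem_of_ringHom φ (s := s) (t := t) m ?_ ?_ ?_ hs hst
    · simp [hφ]
    · simp [hφ]
    · simp [hφ, ht]
  have hmem : x ⟨1, by omega⟩ ∈ I := hI ▸ Ideal.subset_span (by simp)
  exact ⟨hred, hnot, redNum_eq_of_pow_notMem m hmem hred hnot⟩
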